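/- arXiv:2308.10579 — 2 statements merged into one kernel-verified Lean document; each statement's English description precedes it below -/
import Mathlib

section
/- Let V be a finite set with |V| = n, where n is even, let p be a demand distribution on V with exactly m unordered pairs of positive demand, and suppose Δ_avg := 2m/n is a positive integer with 2·Δ_avg ≥ 2. Then there exists a simple graph G = (V, E) on exactly the vertex set V (no additional vertices) with maximum degree at most 4·Δ_avg + 1 such that Σ_{{u,v} ⊆ V} p({u,v})·d_G(u,v) ≤ Σ_{v ∈ V, p(v) > 0} p(v)·H_{2·Δ_avg}(p_v) + 1. -/
open scoped ENNReal BigOperators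

/-- Base-`d` entropy of a finitely supported distribution `q`:
`H_d(q) = Σ_{x : q x > 0} q x · log_d (1 / q x)`. -/
noncomputable def entropyBase (d : ℕ) {X : Type*} [Fintype X] (q : X → ℝ) : ℝ :=
  ∑ x, if 0 < q x then q x * Real.logb d (1 / q x) else 0

/-- `p` is a demand distribution on `V`: a symmetric `[0,1]`-valued function on ordered
pairs, vanishing on the diagonal, whose total mass over unordered pairs is 1 (so the
double sum over ordered pairs is 2). -/
def IsDemandDistribution {V : Type*} [Fintype V] (p : V → V → ℝ) : Prop :=
  (∀ u v, p u v = p v u) ∧ (∀ v, p v v = 0) ∧ (∀ u v, 0 ≤ p u v) ∧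
    (∀ u v, p u v ≤ 1) ∧ (∑ u, ∑ v, p u v) = 2

/-- Expected path length `Σ_{{u,v} ⊆ V} p({u,v})·d_G(u,v)` of a host graph `G`
containing `V` via the map `ι`, computed in `ℝ≥0∞` (distance `+∞` for disconnected
pairs, with the convention `0·∞ = 0`); each unordered pair is counted once via the
factor `1/2` on the ordered double sum. -/
noncomputable def expectedPathLength {V W : Type*} [Fintype V] (p : V → V → ℝ)
    (G : SimpleGraph W) (ι : V → W) : ℝ≥0∞ :=
  (1 / 2) * ∑ u, ∑ v, ENNReal.ofReal (p u v) * (G.edist (ι u) (ι v) : ℝ≥0∞)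

/-- The marginal `p(v) = Σ_{u ≠ v} p({v,u})`. -/
noncomputable def marginal {V : Type*} [Fintype V] (p : V → V → ℝ) (v : V) : ℝ :=
  ∑ u, p v u

/-- `Σ_{v ∈ V, p(v) > 0} p(v)·H_d(p_v)` where `p_v(u) = p({v,u})/p(v)`. -/
noncomputable def condEntropySum (d : ℕ) {V : Type*} [Fintype V] (p : V → V → ℝ) : ℝ :=
  ∑ v, if 0 < marginal p v then
    marginal p v * entropyBase d (fun u => p v u / marginal p v) else 0

/-- A rooted tree in which the root (`none`) and every internal node have at most `d` children,
each child being either an internal node or a leaf labelled by an element of `A`. -/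
structure RelayTree {α : Type} (d : ℕ) (A : Finset α) where
  /-- the internal nodes other than the root -/
  Node : Type
  finite : Finite Node
  /-- the parent of an internal node -/
  parent : Node → Option Node
  /-- the parent of a leaf -/
  leafParent : α → Option Node
  /-- the distance from the root -/
  depth : Option Node → ℕ
  depth_none : depth none = 0
  depth_some : ∀ x, depth (some x) = depth (parent x) + 1
  children_le : ∀ y, {x | parent x = y}.ncard + {a | a ∈ A ∧ leafParent a = y}.ncard ≤ d

namespace RelayTree

/-- The tree all of whose leaves are children of the root. -/
def star {α : Type} {d : ℕ} (A : Finset α) (hA : A.card ≤ d) : RelayTree d A where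
  Node := Empty
  finite := inferInstance
  parent := Empty.elim
  leafParent _ := none
  depth _ := 0
  depth_none := rfl
  depth_some x := x.elim
  children_le y := by
    have h1 : {x : Empty | x.elim = y}.ncard = 0 := by
      rw [Set.ncard_eq_zero]; ext x; exact x.elim
    have h2 : {a | a ∈ A ∧ (none : Option Empty) = y}.ncard ≤ (A : Set α).ncard :=
      Set.ncard_le_ncard (fun a ha => ha.1) A.finite_toSet
    rw [Set.ncard_coe_finset] at h2
    exact h1 ▸ (Nat.zero_add _).symm ▸ h2.trans hA

open Classical in
/-- Replace the leaf `b` by an internal node whose children are the leaves in `B`. -/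
noncomputable def expand {α : Type} [Finite α] {d : ℕ} {A : Finset α} (B : Finset α) (b : α)
    (hbB : b ∈ B) (hBd : B.card ≤ d) (T : RelayTree d (insert b (A \ B))) : RelayTree d A where
  Node := Option T.Node
  finite := by have := T.finite; infer_instance
  parent x := (x.elim (T.leafParent b) T.parent).map some
  leafParent a := if a ∈ B then some none else (T.leafParent a).map some
  depth y := y.elim 0 fun x => x.elim (T.depth (T.leafParent b) + 1) fun z => T.depth (some z)
  depth_none := rfl
  depth_some x := by
    have key : ∀ w : Option T.Node, ((w.map some).elim 0 fun x : Option T.Node =>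
        x.elim (T.depth (T.leafParent b) + 1) fun z => T.depth (some z)) = T.depth w := by
      intro w; cases w <;> simp [T.depth_none]
    rw [key]
    cases x
    · rfl
    · exact T.depth_some _
  children_le y := by
    have := T.finite
    have old : ∀ w : Option T.Node,
        {x : Option T.Node | (x.elim (T.leafParent b) T.parent).map some = w.map some}.ncard +
        {a | a ∈ A ∧ (if a ∈ B then some none else (T.leafParent a).map some) =
          w.map some}.ncard ≤ d := by
      intro w
      have inj : Function.Injective (Option.map (some : T.Node → Option T.Node)) :=
        Option.map_injective (Option.some_injective _)
      have hleaf : {a | a ∈ A ∧ (if a ∈ B then some none else (T.leafParent a).map some) =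
          w.map some} = {a | a ∈ A \ B ∧ T.leafParent a = w} := by
        ext a
        by_cases ha : a ∈ B
        · cases w <;> simp [ha]
        · simp [ha, inj.eq_iff]
      rw [hleaf]
      refine le_trans ?_ (T.children_le w)
      by_cases hb : T.leafParent b = w
      · have h1 : {x : Option T.Node | (x.elim (T.leafParent b) T.parent).map some = w.map some}
            ⊆ insert none (some '' {x | T.parent x = w}) := by
          rintro (_ | x) hx
          · exact Or.inl rfl
          · exact Or.inr ⟨x, inj hx, rfl⟩
        have h2 : {a | a ∈ insert b (A \ B) ∧ T.leafParent a = w} =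
            insert b {a | a ∈ A \ B ∧ T.leafParent a = w} := by
          ext a
          simp only [Finset.mem_insert, Set.mem_ofPred_eq, Set.mem_insert_iff]
          constructor
          · rintro ⟨h | h, h'⟩
            · exact Or.inl h
            · exact Or.inr ⟨h, h'⟩
          · rintro (rfl | ⟨h, h'⟩)
            · exact ⟨Or.inl rfl, hb⟩
            · exact ⟨Or.inr h, h'⟩
        have h3 : b ∉ {a | a ∈ A \ B ∧ T.leafParent a = w} := by simp [hbB]
        rw [h2, Set.ncard_insert_of_notMem h3]
        have h4 := Set.ncard_le_ncard h1
        have h5 := Set.ncard_insert_le none (some '' {x | T.parent x = w})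
        have h6 := Set.ncard_image_le (f := some) (Set.toFinite {x | T.parent x = w})
        omega
      · have h1 : {x : Option T.Node | (x.elim (T.leafParent b) T.parent).map some = w.map some}
            ⊆ some '' {x | T.parent x = w} := by
          rintro (_ | x) hx
          · exact absurd (inj hx) hb
          · exact ⟨x, inj hx, rfl⟩
        have h4 := Set.ncard_le_ncard h1
        have h6 := Set.ncard_image_le (f := some) (Set.toFinite {x | T.parent x = w})
        have h7 : {a | a ∈ A \ B ∧ T.leafParent a = w}.ncard ≤
            {a | a ∈ insert b (A \ B) ∧ T.leafParent a = w}.ncard :=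
          Set.ncard_le_ncard fun a ha => ⟨Finset.mem_insert_of_mem ha.1, ha.2⟩
        omega
    rcases y with _ | _ | z
    · exact old none
    · have h1 : {x : Option T.Node | (x.elim (T.leafParent b) T.parent).map some =
          some none} = ∅ := by
        ext x; simp
      have h2 : {a | a ∈ A ∧ (if a ∈ B then some none else (T.leafParent a).map some) =
          some (none : Option T.Node)} ⊆ (B : Set α) := by
        rintro a ⟨-, ha⟩
        by_contra hB
        simp only [Finset.mem_coe] at hB
        simp [hB] at ha
      have h3 := Set.ncard_le_ncard h2
      rw [Set.ncard_coe_finset] at h3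
      rw [h1, Set.ncard_empty]
      omega
    · exact old (some z)

/-- Relabel along an injection, discarding the leaves outside of its range. -/
def comap {α β : Type} [Finite β] {d : ℕ} {A : Finset α} {B : Finset β} (f : α → β)
    (hf : Function.Injective f) (hAB : ∀ a ∈ A, f a ∈ B) (T : RelayTree d B) : RelayTree d A where
  Node := T.Node
  finite := T.finite
  parent := T.parent
  leafParent a := T.leafParent (f a)
  depth := T.depth
  depth_none := T.depth_none
  depth_some := T.depth_some
  children_le y := by
    refine le_trans (Nat.add_le_add_left ?_ _) (T.children_le y)
    rw [← Set.ncard_image_of_injective _ hf]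
    refine Set.ncard_le_ncard ?_ (Set.toFinite _)
    rintro _ ⟨a, ha, rfl⟩
    exact ⟨hAB a ha.1, ha.2⟩

open Classical in
/-- Leaf depths attaining equality in Kraft's inequality are realised by a full tree. -/
theorem exists_of_kraft_eq {α : Type} [Finite α] {d : ℕ} (hd : 2 ≤ d) (k : ℕ) :
    ∀ (L : ℕ) (A : Finset α) (l : α → ℕ), L + A.card = k → 1 ≤ L →
      (∀ a ∈ A, 1 ≤ l a ∧ l a ≤ L) → ∑ a ∈ A, d ^ (L - l a) = d ^ L →
      ∃ T : RelayTree d A, (∀ a ∈ A, T.depth (T.leafParent a) + 1 ≤ l a) ∧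
        d * Nat.card T.Node + d ≤ A.card + Nat.card T.Node := by
  induction k using Nat.strong_induction_on with
  | _ k ih =>
  intro L A l hk hL hl hsum
  obtain rfl | hL2 : L = 1 ∨ 2 ≤ L := by omega
  · have hcard : A.card = d := by
      rw [Finset.card_eq_sum_ones, ← pow_one d, ← hsum]
      refine Finset.sum_congr rfl fun a ha => ?_
      have := hl a ha
      rw [show 1 - l a = 0 by omega, pow_zero]
    refine ⟨star A hcard.le, fun a ha => (hl a ha).1, ?_⟩
    have : Nat.card (star A hcard.le).Node = 0 := Nat.card_eq_zero.2 (Or.inl ⟨Empty.elim⟩)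
    rw [this]; omega
  obtain ⟨M, rfl⟩ : ∃ M, L = M + 1 := ⟨L - 1, by omega⟩
  have hdvd : d ∣ (A.filter fun a => l a = M + 1).card := by
    have h1 : d ∣ ∑ a ∈ A with ¬ l a = M + 1, d ^ (M + 1 - l a) := by
      refine Finset.dvd_sum fun a ha => ?_
      rw [Finset.mem_filter] at ha
      have := hl a ha.1
      exact dvd_pow_self d (by omega)
    have h2 : ∑ a ∈ A with l a = M + 1, d ^ (M + 1 - l a) =
        (A.filter fun a => l a = M + 1).card := by
      rw [Finset.card_eq_sum_ones]
      refine Finset.sum_congr rfl fun a ha => ?_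
      rw [(Finset.mem_filter.1 ha).2, Nat.sub_self, pow_zero]
    have h3 := Finset.sum_filter_add_sum_filter_not A (fun a => l a = M + 1)
      (fun a => d ^ (M + 1 - l a))
    rw [h2, hsum] at h3
    exact (Nat.dvd_add_left h1).1 (h3 ▸ dvd_pow_self d (by omega))
  rcases (A.filter fun a => l a = M + 1).eq_empty_or_nonempty with he | hne
  · have hlt : ∀ a ∈ A, l a ≤ M := fun a ha => by
      have h1 := hl a ha
      have h2 : ¬ l a = M + 1 := fun h => by
        have : a ∈ A.filter fun a => l a = M + 1 := Finset.mem_filter.2 ⟨ha, h⟩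
        simp [he] at this
      omega
    refine ih (M + A.card) (by omega) M A l rfl (by omega)
      (fun a ha => ⟨(hl a ha).1, hlt a ha⟩) ?_
    refine Nat.eq_of_mul_eq_mul_left (by omega : 0 < d) ?_
    rw [← pow_succ', ← hsum, Finset.mul_sum]
    refine Finset.sum_congr rfl fun a ha => ?_
    rw [← pow_succ', Nat.sub_add_comm (hlt a ha)]
  · obtain ⟨B, hBs, hBd⟩ :=
      Finset.exists_subset_card_eq (Nat.le_of_dvd hne.card_pos hdvd)
    have hBA : B ⊆ A := hBs.trans (Finset.filter_subset _ _)
    have hBl : ∀ a ∈ B, l a = M + 1 := fun a ha => (Finset.mem_filter.1 (hBs ha)).2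
    obtain ⟨b, hb⟩ : B.Nonempty := Finset.card_pos.1 (by omega)
    have hbn : b ∉ A \ B := by simp [hb]
    have hc : (A \ B).card + d = A.card := by
      rw [← hBd]; exact Finset.card_sdiff_add_card_eq_card hBA
    have hci : (insert b (A \ B)).card = (A \ B).card + 1 := Finset.card_insert_of_notMem hbn
    have hbound : ∀ a ∈ insert b (A \ B),
        1 ≤ Function.update l b M a ∧ Function.update l b M a ≤ M + 1 := by
      intro a ha
      rcases Finset.mem_insert.1 ha with rfl | ha'
      · rw [Function.update_self]; omega
      · rw [Function.update_of_ne (by rintro rfl; exact hbn ha')]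
        exact hl a (Finset.mem_sdiff.1 ha').1
    have hkraft : ∑ a ∈ insert b (A \ B), d ^ (M + 1 - Function.update l b M a) =
        d ^ (M + 1) := by
      rw [Finset.sum_insert hbn, Function.update_self, ← hsum, ← Finset.sum_sdiff hBA, add_comm]
      congr 1
      · refine Finset.sum_congr rfl fun a ha => ?_
        rw [Function.update_of_ne (by rintro rfl; exact hbn ha)]
      · rw [Finset.sum_congr rfl fun a ha => by rw [hBl a ha, Nat.sub_self, pow_zero],
          ← Finset.card_eq_sum_ones, hBd]
        simp
    obtain ⟨T, hT, hTc⟩ := ih (M + 1 + (insert b (A \ B)).card) (by omega) (M + 1)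
      (insert b (A \ B)) (Function.update l b M) rfl hL hbound hkraft
    refine ⟨T.expand B b hb hBd.le, fun a ha => ?_, ?_⟩
    · by_cases haB : a ∈ B
      · have h1 := hT b (Finset.mem_insert_self _ _)
        rw [Function.update_self] at h1
        have : (T.expand (A := A) B b hb hBd.le).depth
            ((T.expand (A := A) B b hb hBd.le).leafParent a) =
            T.depth (T.leafParent b) + 1 := by
          simp [expand, haB]
        rw [this, hBl a haB]; omega
      · have h1 := hT a (Finset.mem_insert_of_mem (Finset.mem_sdiff.2 ⟨ha, haB⟩))
        rw [Function.update_of_ne (by rintro rfl; exact haB hb)] at h1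
        have : (T.expand (A := A) B b hb hBd.le).depth
            ((T.expand (A := A) B b hb hBd.le).leafParent a) = T.depth (T.leafParent a) := by
          simp only [expand, haB, if_false]
          cases T.leafParent a <;> simp [T.depth_none]
        rw [this]; exact h1
    · have := T.finite
      have hN : Nat.card (T.expand (A := A) B b hb hBd.le).Node = Nat.card T.Node + 1 :=
        Finite.card_option
      rw [hN, mul_add]
      omega

open Classical in
/-- Kraft's inequality suffices for a tree with the given bounds on its leaf depths and with few
internal nodes. -/
theorem exists_of_kraft_le {α : Type} [Finite α] {d : ℕ} (hd : 2 ≤ d) (k : ℕ) :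
    ∀ (L : ℕ) (A : Finset α) (l : α → ℕ), L + ∑ a ∈ A, l a = k → 1 ≤ L →
      (∀ a ∈ A, 1 ≤ l a ∧ l a ≤ L) → ∑ a ∈ A, d ^ (L - l a) ≤ d ^ L →
      ∃ T : RelayTree d A, (∀ a ∈ A, T.depth (T.leafParent a) + 1 ≤ l a) ∧
        d * Nat.card T.Node ≤ A.card + Nat.card T.Node := by
  induction k using Nat.strong_induction_on with
  | _ k ih =>
  intro L A l hk hL hl hsum
  obtain rfl | hL2 : L = 1 ∨ 2 ≤ L := by omega
  · have hcard : A.card ≤ d := by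
      rw [Finset.card_eq_sum_ones, ← pow_one d]
      refine le_trans (le_of_eq (Finset.sum_congr rfl fun a ha => ?_)) hsum
      have := hl a ha
      rw [show 1 - l a = 0 by omega, pow_zero]
    refine ⟨star A hcard, fun a ha => (hl a ha).1, ?_⟩
    have : Nat.card (star A hcard).Node = 0 := Nat.card_eq_zero.2 (Or.inl ⟨Empty.elim⟩)
    rw [this]; omega
  obtain ⟨M, rfl⟩ : ∃ M, L = M + 1 := ⟨L - 1, by omega⟩
  by_cases hex : ∃ a ∈ A, l a = M + 1
  · obtain ⟨b, hb, hbl⟩ := hex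
    by_cases hs : ∑ a ∈ A, d ^ (M + 1 - l a) + (d - 1) ≤ d ^ (M + 1)
    · have hle : ∀ a, Function.update l b M a ≤ l a := fun a => by
        by_cases h : a = b
        · subst h; rw [Function.update_self]; omega
        · rw [Function.update_of_ne h]
      have hoff : ∀ a ∈ A.erase b, Function.update l b M a = l a := fun a ha =>
        Function.update_of_ne (Finset.ne_of_mem_erase ha) _ _
      have hlt : ∑ a ∈ A, Function.update l b M a < ∑ a ∈ A, l a :=
        Finset.sum_lt_sum (fun a _ => hle a) ⟨b, hb, by rw [Function.update_self]; omega⟩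
      have hbound : ∀ a ∈ A, 1 ≤ Function.update l b M a ∧ Function.update l b M a ≤ M + 1 := by
        intro a ha
        refine ⟨?_, (hle a).trans (hl a ha).2⟩
        by_cases h : a = b
        · subst h; rw [Function.update_self]; omega
        · rw [Function.update_of_ne h]; exact (hl a ha).1
      have hkraft : ∑ a ∈ A, d ^ (M + 1 - Function.update l b M a) ≤ d ^ (M + 1) := by
        rw [← Finset.add_sum_erase _ _ hb] at hs ⊢
        rw [Finset.sum_congr rfl fun a ha => by rw [hoff a ha], Function.update_self]
        rw [hbl, Nat.sub_self, pow_zero] at hs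
        simp only [Nat.add_sub_cancel_left, pow_one]
        omega
      obtain ⟨T, hT, hTc⟩ := ih (M + 1 + ∑ a ∈ A, Function.update l b M a) (by omega) (M + 1) A
        (Function.update l b M) rfl hL hbound hkraft
      exact ⟨T, fun a ha => (hT a ha).trans (hle a), hTc⟩
    · obtain ⟨s, hs'⟩ := Nat.exists_eq_add_of_le hsum
      have hbound : ∀ a ∈ A.disjSum (Finset.univ : Finset (Fin s)),
          1 ≤ Sum.elim l (fun _ => M + 1) a ∧ Sum.elim l (fun _ => M + 1) a ≤ M + 1 := by
        intro a ha
        rcases a with a | a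
        · exact hl a (by simpa using ha)
        · simp
      have hkraft : ∑ a ∈ A.disjSum (Finset.univ : Finset (Fin s)),
          d ^ (M + 1 - Sum.elim l (fun _ => M + 1) a) = d ^ (M + 1) := by
        rw [Finset.sum_disjSum]
        simp [hs']
      obtain ⟨T, hT, hTc⟩ := exists_of_kraft_eq (α := α ⊕ Fin s) hd _ (M + 1)
        (A.disjSum Finset.univ) (Sum.elim l fun _ => M + 1) rfl hL hbound hkraft
      refine ⟨T.comap (A := A) Sum.inl Sum.inl_injective (by simp), fun a ha => ?_, ?_⟩
      · exact hT (Sum.inl a) (by simpa using ha)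
      · have hN : Nat.card (T.comap (A := A) Sum.inl Sum.inl_injective (by simp)).Node =
          Nat.card T.Node := rfl
        rw [Finset.card_disjSum, Finset.card_univ, Fintype.card_fin] at hTc
        rw [hN]
        omega
  · have hlt : ∀ a ∈ A, l a ≤ M := fun a ha => by
      have h1 := hl a ha
      have h2 : ¬ l a = M + 1 := fun h => hex ⟨a, ha, h⟩
      omega
    refine ih (M + ∑ a ∈ A, l a) (by omega) M A l rfl (by omega)
      (fun a ha => ⟨(hl a ha).1, hlt a ha⟩) ?_
    refine Nat.le_of_mul_le_mul_left ?_ (by omega : 0 < d)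
    rw [← pow_succ', Finset.mul_sum]
    refine le_trans (le_of_eq (Finset.sum_congr rfl fun a ha => ?_)) hsum
    rw [← pow_succ', Nat.sub_add_comm (hlt a ha)]

/-- A Shannon code for the distribution `q` on `A`, as a tree with few internal nodes. -/
theorem exists_depth_le_logb {α : Type} [Finite α] {d : ℕ} (hd : 2 ≤ d) (A : Finset α)
    (q : α → ℝ) (hq : ∀ a ∈ A, 0 < q a) (hsum : ∑ a ∈ A, q a ≤ 1) :
    ∃ T : RelayTree d A, (∀ a ∈ A, (T.depth (T.leafParent a) : ℝ) ≤ Real.logb d (1 / q a)) ∧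
      d * Nat.card T.Node ≤ A.card + Nat.card T.Node := by
  have hd1 : (1 : ℝ) < d := by exact_mod_cast hd
  have hd0 : (0 : ℝ) < d := by linarith
  set l : α → ℕ := fun a => max 1 ⌈Real.logb d (1 / q a)⌉₊ with hldef
  have hq1 : ∀ a ∈ A, q a ≤ 1 := fun a ha =>
    (Finset.single_le_sum (fun b hb => (hq b hb).le) ha).trans hsum
  have hlogb : ∀ a ∈ A, 0 ≤ Real.logb d (1 / q a) := fun a ha =>
    Real.logb_nonneg hd1 ((one_le_div (hq a ha)).2 (hq1 a ha))
  have hkraft : ∀ a ∈ A, 1 ≤ q a * (d : ℝ) ^ l a := fun a ha => by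
    have h1 : Real.logb d (1 / q a) ≤ (l a : ℝ) :=
      (Nat.le_ceil _).trans (by exact_mod_cast le_max_right _ _)
    rw [Real.logb_le_iff_le_rpow hd1 (one_div_pos.2 (hq a ha)), Real.rpow_natCast,
      div_le_iff₀ (hq a ha)] at h1
    linarith
  have hlL : ∀ a ∈ A, 1 ≤ l a ∧ l a ≤ A.sup l + 1 := fun a ha =>
    ⟨le_max_left _ _, (Finset.le_sup ha).trans (Nat.le_succ _)⟩
  have hk : ∑ a ∈ A, d ^ (A.sup l + 1 - l a) ≤ d ^ (A.sup l + 1) := by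
    have : ∑ a ∈ A, (d : ℝ) ^ (A.sup l + 1 - l a) ≤ (d : ℝ) ^ (A.sup l + 1) := by
      calc ∑ a ∈ A, (d : ℝ) ^ (A.sup l + 1 - l a)
          ≤ ∑ a ∈ A, q a * (d : ℝ) ^ (A.sup l + 1) := by
            refine Finset.sum_le_sum fun a ha => ?_
            have h1 := hkraft a ha
            have h2 : (d : ℝ) ^ (A.sup l + 1) =
                (d : ℝ) ^ l a * (d : ℝ) ^ (A.sup l + 1 - l a) := by
              rw [← pow_add, Nat.add_sub_cancel' (hlL a ha).2]
            have h3 : 0 < (d : ℝ) ^ (A.sup l + 1 - l a) := pow_pos hd0 _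
            rw [h2]
            nlinarith
        _ = (∑ a ∈ A, q a) * (d : ℝ) ^ (A.sup l + 1) := by rw [Finset.sum_mul]
        _ ≤ 1 * (d : ℝ) ^ (A.sup l + 1) := by gcongr
        _ = _ := one_mul _
    exact_mod_cast this
  obtain ⟨T, hT, hTc⟩ := exists_of_kraft_le hd _ (A.sup l + 1) A l rfl (by omega) hlL hk
  refine ⟨T, fun a ha => ?_, hTc⟩
  have h1 : ((T.depth (T.leafParent a) : ℝ) + 1) ≤ l a := by exact_mod_cast hT a ha
  have h2 : (l a : ℝ) ≤ Real.logb d (1 / q a) + 1 := by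
    rw [hldef]
    push_cast
    exact max_le (by linarith [hlogb a ha]) (Nat.ceil_lt_add_one (hlogb a ha)).le
  linarith

end RelayTree

/-- A family of trees, one for each vertex, all of whose internal nodes are hosted by distinct
vertices of `V`. -/
structure RelayForest {V : Type} (d : ℕ) (A : V → Finset V) where
  /-- the tree rooted at a vertex -/
  tree : ∀ v, RelayTree d (A v)
  /-- the vertex hosting an internal node -/
  host : (Σ v, (tree v).Node) → V
  host_injective : Function.Injective host

namespace RelayForest

variable {V : Type} {d : ℕ} {A : V → Finset V} (F : RelayForest d A)

/-- The vertex at which a node of the tree of `v` is placed. -/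
def place (v : V) (y : Option (F.tree v).Node) : V :=
  y.elim v fun x => F.host ⟨v, x⟩

/-- The vertices at which the children of a node are placed, where the leaf `u` of the tree of `v`
is identified with the parent of the leaf `v` in the tree of `u`. -/
def children (v : V) (y : Option (F.tree v).Node) : Set V :=
  (fun x => F.host ⟨v, x⟩) '' {x | (F.tree v).parent x = y} ∪
    (fun u => F.place u ((F.tree u).leafParent v)) '' {u | u ∈ A v ∧ (F.tree v).leafParent u = y}

/-- The host graph, which joins each node to its children. -/
def graph : SimpleGraph V :=
  SimpleGraph.fromRel fun a b => ∃ v y, a = F.place v y ∧ b ∈ F.children v y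

theorem ncard_children_le [Finite V] (v : V) (y : Option (F.tree v).Node) :
    (F.children v y).ncard ≤ d := by
  have := (F.tree v).finite
  refine (Set.ncard_union_le _ _).trans (le_trans ?_ ((F.tree v).children_le y))
  exact add_le_add (Set.ncard_image_le (Set.toFinite _)) (Set.ncard_image_le (Set.toFinite _))

theorem ncard_neighborSet_le [Finite V] (hA : ∀ u v, u ∈ A v → v ∈ A u) (w : V) :
    (F.graph.neighborSet w).ncard ≤ 2 * d + 1 := by
  have hsub : F.graph.neighborSet w ⊆ F.children w none ∪ {b | ∃ v x, w = F.host ⟨v, x⟩ ∧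
      (b ∈ F.children v (some x) ∨ b = F.place v ((F.tree v).parent x))} := by
    have hdown : ∀ v y b, w = F.place v y → b ∈ F.children v y → b ∈ F.children w none ∪
        {b | ∃ v x, w = F.host ⟨v, x⟩ ∧
          (b ∈ F.children v (some x) ∨ b = F.place v ((F.tree v).parent x))} := by
      rintro v (_ | x) b hw hb
      · obtain rfl : w = v := hw
        exact Or.inl hb
      · exact Or.inr ⟨v, x, hw, Or.inl hb⟩
    rintro b ⟨-, ⟨v, y, hw, hb⟩ | ⟨v, y, hb, ⟨x, hx, hw⟩ | ⟨u, ⟨hu, hy⟩, hw⟩⟩⟩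
    · exact hdown v y b hw hb
    · exact Or.inr ⟨v, x, hw.symm, Or.inr (by rw [hb, ← hx])⟩
    · refine hdown u _ b hw.symm (Or.inr ⟨v, ⟨hA u v hu, rfl⟩, ?_⟩)
      rw [hb, ← hy]
  have hrole : {b | ∃ v x, w = F.host ⟨v, x⟩ ∧
      (b ∈ F.children v (some x) ∨ b = F.place v ((F.tree v).parent x))}.ncard ≤ d + 1 := by
    by_cases hw : ∃ v x, w = F.host ⟨v, x⟩
    · obtain ⟨v, x, hw⟩ := hw
      have : {b | ∃ v x, w = F.host ⟨v, x⟩ ∧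
          (b ∈ F.children v (some x) ∨ b = F.place v ((F.tree v).parent x))} ⊆
          insert (F.place v ((F.tree v).parent x)) (F.children v (some x)) := by
        rintro b ⟨v', x', hw', hb⟩
        obtain ⟨rfl, hx⟩ := Sigma.mk.inj (F.host_injective (hw.symm.trans hw'))
        obtain rfl := eq_of_heq hx
        exact hb.symm
      refine (Set.ncard_le_ncard this (Set.toFinite _)).trans ((Set.ncard_insert_le _ _).trans ?_)
      exact Nat.add_le_add_right (F.ncard_children_le v (some x)) 1
    · have : {b | ∃ v x, w = F.host ⟨v, x⟩ ∧
          (b ∈ F.children v (some x) ∨ b = F.place v ((F.tree v).parent x))} = ∅ := by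
        ext b
        simp only [Set.mem_ofPred_eq, Set.mem_empty_iff_false, iff_false]
        rintro ⟨v, x, h, -⟩
        exact hw ⟨v, x, h⟩
      rw [this, Set.ncard_empty]
      omega
  have h1 := Set.ncard_le_ncard hsub (Set.toFinite _)
  have h2 := h1.trans (Set.ncard_union_le _ _)
  have h3 := F.ncard_children_le w none
  omega

theorem edist_le_one {v b : V} (y : Option (F.tree v).Node) (hb : b ∈ F.children v y) :
    F.graph.edist (F.place v y) b ≤ 1 := by
  by_cases h : F.place v y = b
  · rw [h, SimpleGraph.edist_self]
    exact bot_le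
  · have hadj : F.graph.Adj (F.place v y) b := ⟨h, Or.inl ⟨v, y, rfl, hb⟩⟩
    rw [SimpleGraph.edist_eq_one_iff_adj.2 hadj]

theorem edist_place_le (v : V) (k : ℕ) : ∀ y : Option (F.tree v).Node, (F.tree v).depth y = k →
    F.graph.edist v (F.place v y) ≤ k := by
  induction k with
  | zero =>
    rintro (_ | x) hy
    · exact (SimpleGraph.edist_self (G := F.graph) (v := v)).le
    · rw [(F.tree v).depth_some] at hy
      omega
  | succ k ih =>
    rintro (_ | x) hy
    · rw [(F.tree v).depth_none] at hy
      omega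
    · rw [(F.tree v).depth_some] at hy
      refine (SimpleGraph.edist_triangle (v := F.place v ((F.tree v).parent x))).trans ?_
      push_cast
      exact add_le_add (ih _ (by omega)) (F.edist_le_one _ (Or.inl ⟨x, rfl, rfl⟩))

theorem edist_le {u v : V} (h : u ∈ A v) : F.graph.edist v u ≤
    (((F.tree v).depth ((F.tree v).leafParent u) + 1 +
      (F.tree u).depth ((F.tree u).leafParent v) : ℕ) : ℕ∞) := by
  refine (SimpleGraph.edist_triangle (v := F.place u ((F.tree u).leafParent v))).trans ?_
  rw [Nat.cast_add]
  refine add_le_add ?_ ?_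
  · refine (SimpleGraph.edist_triangle (v := F.place v ((F.tree v).leafParent u))).trans ?_
    rw [Nat.cast_add, Nat.cast_one]
    exact add_le_add (F.edist_place_le v _ _ rfl) (F.edist_le_one _ (Or.inr ⟨u, ⟨h, rfl⟩, rfl⟩))
  · rw [SimpleGraph.edist_comm]
    exact F.edist_place_le u _ _ rfl

end RelayForest

/-- The entropy sum as a sum over the pairs of positive demand. -/
theorem condEntropySum_eq {V : Type} [Fintype V] (d : ℕ) {p : V → V → ℝ}
    (hp : ∀ u v, 0 ≤ p u v) :
    condEntropySum d p = ∑ v, ∑ u, p v u * Real.logb d (1 / (p v u / marginal p v)) := by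
  unfold condEntropySum entropyBase
  refine Finset.sum_congr rfl fun v _ => ?_
  split_ifs with hv
  · rw [Finset.mul_sum]
    refine Finset.sum_congr rfl fun u _ => ?_
    split_ifs with hu
    · field_simp
    · have : p v u = 0 := by
        by_contra h
        exact hu (div_pos (lt_of_le_of_ne (hp v u) (Ne.symm h)) hv)
      simp [this]
  · have h0 : marginal p v = 0 := le_antisymm (not_lt.1 hv) (Finset.sum_nonneg fun u _ => hp v u)
    have h1 := (Finset.sum_eq_zero_iff_of_nonneg fun u _ => hp v u).1 h0
    exact (Finset.sum_eq_zero fun u hu => by rw [h1 u hu, zero_mul]).symm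

open Classical in
theorem exists_relayForest {V : Type} [Fintype V] {p : V → V → ℝ} {d : ℕ} (hd : 2 ≤ d)
    (hp : ∀ u v, 0 ≤ p u v)
    (hcard : (Finset.univ.filter fun uv : V × V => 0 < p uv.1 uv.2).card + Fintype.card V ≤
      d * Fintype.card V) :
    ∃ F : RelayForest d (fun v : V => Finset.univ.filter fun u => 0 < p v u),
      ∀ v u, 0 < p v u → ((F.tree v).depth ((F.tree v).leafParent u) : ℝ) ≤
        Real.logb d (1 / (p v u / marginal p v)) := by
  have hmarg : ∀ v u, 0 < p v u → 0 < marginal p v := fun v u h =>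
    lt_of_lt_of_le h (Finset.single_le_sum (fun u _ => hp v u) (Finset.mem_univ u))
  have htree : ∀ v, ∃ T : RelayTree d (Finset.univ.filter fun u => 0 < p v u),
      (∀ u, 0 < p v u → (T.depth (T.leafParent u) : ℝ) ≤
        Real.logb d (1 / (p v u / marginal p v))) ∧
      d * Nat.card T.Node ≤ (Finset.univ.filter fun u => 0 < p v u).card + Nat.card T.Node := by
    intro v
    obtain ⟨T, hT, hTc⟩ := RelayTree.exists_depth_le_logb hd
      (Finset.univ.filter fun u => 0 < p v u) (fun u => p v u / marginal p v)
      (fun u hu => by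
        have hu := (Finset.mem_filter.1 hu).2
        exact div_pos hu (hmarg v u hu))
      (by
        rw [← Finset.sum_div]
        refine div_le_one_of_le₀ ?_ (Finset.sum_nonneg fun u _ => hp v u)
        exact Finset.sum_le_sum_of_subset_of_nonneg (Finset.filter_subset _ _)
          fun u _ _ => hp v u)
    exact ⟨T, fun u hu => hT u (by simpa using hu), hTc⟩
  choose T hT hTc using htree
  have hfin : ∀ v, Finite (T v).Node := fun v => (T v).finite
  have hle : Nat.card (Σ v, (T v).Node) ≤ Nat.card V := by
    rw [Nat.card_sigma, Nat.card_eq_fintype_card]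
    have h1 := Finset.sum_le_sum fun v (_ : v ∈ Finset.univ) => hTc v
    rw [← Finset.mul_sum, Finset.sum_add_distrib] at h1
    have h2 : ∑ v, (Finset.univ.filter fun u => 0 < p v u).card =
        (Finset.univ.filter fun uv : V × V => 0 < p uv.1 uv.2).card := by
      simp only [Finset.card_filter]
      rw [Fintype.sum_prod_type]
    rw [h2] at h1
    by_contra hlt
    push Not at hlt
    obtain ⟨e, rfl⟩ : ∃ e, d = e + 2 := ⟨d - 2, by omega⟩
    nlinarith
  have hinj : ∃ f : (Σ v, (T v).Node) → V, Function.Injective f := by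
    have := Fintype.ofFinite (Σ v, (T v).Node)
    rw [Nat.card_eq_fintype_card, Nat.card_eq_fintype_card] at hle
    obtain ⟨f⟩ := Function.Embedding.nonempty_of_card_le hle
    exact ⟨f, f.injective⟩
  obtain ⟨f, hf⟩ := hinj
  exact ⟨⟨T, f, hf⟩, hT⟩

/-- demand balancing. If the demand graph has `m` edges, `n = |V|` is even
and `Δ_avg = 2m/n` is a positive integer, then there is a host graph on exactly the
vertex set `V` with maximum degree at most `4·Δ_avg + 1` whose expected path length is
at most `Σ_{v, p(v)>0} p(v)·H_{2·Δ_avg}(p_v) + 1`. -/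
theorem statement_8 {V : Type} [Fintype V] (n : ℕ) (hn : Fintype.card V = n)
    (hneven : Even n) (p : V → V → ℝ) (hp : IsDemandDistribution p) (m : ℕ)
    (hm : (Finset.univ.filter fun uv : V × V => 0 < p uv.1 uv.2).card = 2 * m)
    (Davg : ℕ) (hDavg : 1 ≤ Davg) (havg : Davg * n = 2 * m) :
    ∃ G : SimpleGraph V,
      (∀ v : V, (G.neighborSet v).ncard ≤ 4 * Davg + 1) ∧
      expectedPathLength p G id ≤
        ENNReal.ofReal (condEntropySum (2 * Davg) p + 1) := by
  classical
  obtain ⟨hsymm, -, hnn, -, htot⟩ := hp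
  subst hn
  have hcard : (Finset.univ.filter fun uv : V × V => 0 < p uv.1 uv.2).card + Fintype.card V ≤
      (2 * Davg) * Fintype.card V := by
    have h : (Finset.univ.filter fun uv : V × V => 0 < p uv.1 uv.2).card =
        Davg * Fintype.card V := by
      rw [havg, ← hm]
    rw [h]
    nlinarith
  obtain ⟨F, hF⟩ := exists_relayForest (d := 2 * Davg) (by omega) hnn hcard
  refine ⟨F.graph, fun v => ?_, ?_⟩
  · have := F.ncard_neighborSet_le (fun u v h => by simpa [hsymm u v] using h) v
    omega
  set x : V → V → ℝ := fun v u =>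
    p v u * Real.logb (2 * Davg : ℕ) (1 / (p v u / marginal p v)) with hx
  have hterm : ∀ u v, ENNReal.ofReal (p u v) * (F.graph.edist (id u) (id v) : ℝ≥0∞) ≤
      ENNReal.ofReal (x u v + x v u + p u v) := by
    intro u v
    rcases (hnn u v).eq_or_lt with h0 | h0
    · simp [← h0]
    · have h1 : 0 < p v u := hsymm u v ▸ h0
      have h2 : (F.graph.edist u v : ℝ≥0∞) ≤
          ENNReal.ofReal (((F.tree u).depth ((F.tree u).leafParent v) + 1 +
            (F.tree v).depth ((F.tree v).leafParent u) : ℕ) : ℝ) := by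
        rw [ENNReal.ofReal_natCast]
        exact_mod_cast F.edist_le (u := v) (v := u) (by simpa using h0)
      refine (mul_le_mul_right h2 _).trans ?_
      rw [← ENNReal.ofReal_mul h0.le]
      refine ENNReal.ofReal_le_ofReal ?_
      have h3 := mul_le_mul_of_nonneg_left (hF u v h0) h0.le
      have h4 := mul_le_mul_of_nonneg_left (hF v u h1) h1.le
      rw [hx]
      push_cast at h3 h4 ⊢
      rw [hsymm v u] at h4 ⊢
      linarith
  have hxnn : ∀ u v, 0 ≤ x u v := by
    intro u v
    rcases (hnn u v).eq_or_lt with h0 | h0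
    · simp [hx, ← h0]
    · exact mul_nonneg h0.le ((Nat.cast_nonneg _).trans (hF u v h0))
  have hsum : ∑ u, ∑ v, (x u v + x v u + p u v) = 2 * (condEntropySum (2 * Davg) p + 1) := by
    rw [condEntropySum_eq _ hnn]
    simp only [Finset.sum_add_distrib]
    rw [htot, Finset.sum_comm (f := fun u v => x v u)]
    ring
  have hyn : ∀ u v, 0 ≤ x u v + x v u + p u v := fun u v =>
    add_nonneg (add_nonneg (hxnn u v) (hxnn v u)) (hnn u v)
  calc expectedPathLength p F.graph id
      ≤ (1 / 2) * ∑ u, ∑ v, ENNReal.ofReal (x u v + x v u + p u v) := by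
        unfold expectedPathLength
        gcongr with u _ v _
        exact hterm u v
    _ = (1 / 2) * ENNReal.ofReal (2 * (condEntropySum (2 * Davg) p + 1)) := by
        rw [← hsum, ENNReal.ofReal_sum_of_nonneg fun u _ => Finset.sum_nonneg fun v _ => hyn u v]
        congr 1
        refine Finset.sum_congr rfl fun u _ => ?_
        rw [ENNReal.ofReal_sum_of_nonneg fun v _ => hyn u v]
    _ = ENNReal.ofReal (condEntropySum (2 * Davg) p + 1) := by
        rw [ENNReal.ofReal_mul (by norm_num), ENNReal.ofReal_ofNat, ← mul_assoc, one_div,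
          ENNReal.inv_mul_cancel (by norm_num) (by norm_num), one_mul]
end

section
/- There exists a constant C > 0 such that the following holds. Let V be a finite set with |V| = n ≥ 1, let p be a demand distribution on V, and let Δ ≥ 1 be an integer. Then there exists a finite simple graph G of maximum degree at most Δ whose vertex set contains V, with at most C·n⁴ vertices, such that for every finite simple graph G' of maximum degree at most Δ whose vertex set contains V, Σ_{{u,v} ⊆ V} p({u,v})·d_G(u,v) ≤ Σ_{{u,v} ⊆ V} p({u,v})·d_{G'}(u,v). -/
open scoped ENNReal BigOperators

namespace SimpleGraph

variable {W : Type*} {G : SimpleGraph W}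

lemma exists_eq_getVert_dist {u v x : W} {p : G.Walk u v} (hp : p.length = G.dist u v)
    (hx : x ∈ p.support) : p.getVert (G.dist u x) = x ∧ G.dist u x ≤ p.length := by
  obtain ⟨n, rfl, hn⟩ := (Walk.mem_support_iff_exists_getVert).1 hx
  have h := length_eq_dist_of_subwalk hp (p.isSubwalk_take n)
  rw [Walk.take_length, min_eq_left hn] at h
  rw [← h]
  exact ⟨rfl, hn⟩

lemma eq_of_dist_eq_of_mem_support {u v x y : W} {p : G.Walk u v} (hp : p.length = G.dist u v)
    (hx : x ∈ p.support) (hy : y ∈ p.support) (h : G.dist u x = G.dist u y) : x = y := by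
  rw [← (exists_eq_getVert_dist hp hx).1, h, (exists_eq_getVert_dist hp hy).1]

lemma exists_isSubwalk_of_dist_le {u v x y : W} {p : G.Walk u v} (hp : p.length = G.dist u v)
    (hx : x ∈ p.support) (hy : y ∈ p.support) (h : G.dist u x ≤ G.dist u y) :
    ∃ q : G.Walk x y, q.IsSubwalk p ∧ q.length = G.dist x y ∧
      G.dist u x + q.length = G.dist u y := by
  obtain ⟨ex, lx⟩ := exists_eq_getVert_dist hp hx
  obtain ⟨ey, ly⟩ := exists_eq_getVert_dist hp hy
  have e : (p.drop (G.dist u x)).getVert (G.dist u y - G.dist u x) = y := by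
    rw [Walk.drop_getVert, Nat.add_sub_cancel' h, ey]
  have hs : (((p.drop (G.dist u x)).take (G.dist u y - G.dist u x)).copy ex e).IsSubwalk p := by
    have := ((p.drop (G.dist u x)).isSubwalk_take (G.dist u y - G.dist u x)).trans
      (p.isSubwalk_drop _)
    exact this.copy ex e rfl rfl
  refine ⟨_, hs, length_eq_dist_of_subwalk hp hs, ?_⟩
  rw [Walk.length_copy, Walk.take_length, Walk.drop_length]
  omega

/-- The edge `e` lies on every shortest walk between the connected vertices `u` and `v`. -/
def IsEssential (G : SimpleGraph W) (u v : W) (e : Sym2 W) : Prop :=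
  G.Reachable u v ∧ ∀ p : G.Walk u v, p.length = G.dist u v → e ∈ p.edges

lemma IsEssential.mem_support {u v w : W} {e : Sym2 W} (h : G.IsEssential u v e) (hw : w ∈ e)
    (p : G.Walk u v) (hp : p.length = G.dist u v) : w ∈ p.support :=
  Walk.mem_support_of_mem_edges (h.2 p hp) hw

lemma IsEssential.symm {u v : W} {e : Sym2 W} (h : G.IsEssential u v e) :
    G.IsEssential v u e := by
  refine ⟨h.1.symm, fun p hp => ?_⟩
  simpa using h.2 p.reverse (by rw [Walk.length_reverse, hp, dist_comm])

lemma IsEssential.extend {u v x y : W} {e : Sym2 W} (h : G.IsEssential x y e)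
    (huv : G.Reachable u v) (hx : ∀ p : G.Walk u v, p.length = G.dist u v → x ∈ p.support)
    (hy : ∀ p : G.Walk u v, p.length = G.dist u v → y ∈ p.support) :
    G.IsEssential u v e := by
  refine ⟨huv, fun p hp => ?_⟩
  rcases le_total (G.dist u x) (G.dist u y) with hle | hle
  · obtain ⟨q, hq, hl, -⟩ := exists_isSubwalk_of_dist_le hp (hx p hp) (hy p hp) hle
    exact hq.edges_subset (h.2 q hl)
  · obtain ⟨q, hq, hl, -⟩ := exists_isSubwalk_of_dist_le hp (hy p hp) (hx p hp) hle
    exact hq.edges_subset (h.symm.2 q hl)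

/-- An essential edge at a vertex strictly between `x` and `y` is essential for `x` and `y`. -/
lemma IsEssential.restrict {u v x y w : W} {e : Sym2 W} (h : G.IsEssential u v e) (hw : w ∈ e)
    {p : G.Walk u v} (hp : p.length = G.dist u v) (hx : x ∈ p.support) (hy : y ∈ p.support)
    (hxw : G.dist u x < G.dist u w) (hwy : G.dist u w < G.dist u y) :
    G.IsEssential x y e := by
  have hwp := h.mem_support hw p hp
  obtain ⟨a, ha, hal, hal'⟩ := exists_isSubwalk_of_dist_le hp p.start_mem_support hx (by simp)
  obtain ⟨m, hm, hml, hml'⟩ := exists_isSubwalk_of_dist_le hp hx hy (hxw.trans hwy).le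
  have hyv : G.dist u y ≤ G.dist u v := hp ▸ (exists_eq_getVert_dist hp hy).2
  have hwv : G.dist u w ≤ G.dist u v := hp ▸ (exists_eq_getVert_dist hp hwp).2
  obtain ⟨b, hb, hbl, hbl'⟩ := exists_isSubwalk_of_dist_le hp hy p.end_mem_support hyv
  obtain ⟨c, hc, hcl, hcl'⟩ := exists_isSubwalk_of_dist_le hp hwp p.end_mem_support hwv
  refine ⟨⟨m⟩, fun q hq => ?_⟩
  have he := h.2 (a.append (q.append b)) (by
    simp only [Walk.length_append]
    simp only [dist_self] at hal'
    omega)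
  simp only [Walk.edges_append, List.mem_append] at he
  rcases he with he | he | he
  · have hwa := Walk.mem_support_of_mem_edges he hw
    have := (exists_eq_getVert_dist hal hwa).2
    omega
  · exact he
  · have hwb := Walk.mem_support_of_mem_edges he hw
    have hwb' : w ∈ b.reverse.support := by simpa using hwb
    have := (exists_eq_getVert_dist (p := b.reverse)
      (by rw [Walk.length_reverse, hbl, dist_comm]) hwb').2
    rw [Walk.length_reverse, dist_comm] at this
    omega

/-- The vertex `w` lies on all shortest walks of the two pairs `P` and `Q`, and some edge at `w`
is essential for `Q` only. -/
def IsBranching (G : SimpleGraph W) (P Q : W × W) (w : W) : Prop :=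
  (∃ e, w ∈ e ∧ G.IsEssential P.1 P.2 e) ∧
    ∃ e, w ∈ e ∧ G.IsEssential Q.1 Q.2 e ∧ ¬ G.IsEssential P.1 P.2 e

lemma not_isBranching_of_dist_lt {P Q : W × W} {x w y : W} (hx : G.IsBranching P Q x)
    (hw : G.IsBranching P Q w) (hy : G.IsBranching P Q y)
    (hxw : G.dist Q.1 x < G.dist Q.1 w) : ¬ G.dist Q.1 w < G.dist Q.1 y := by
  intro hwy
  obtain ⟨⟨ex, hex, hexP⟩, fx, hfx, hfxQ, -⟩ := hx
  obtain ⟨⟨ey, hey, heyP⟩, fy, hfy, hfyQ, -⟩ := hy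
  obtain ⟨-, f, hf, hfQ, hfP⟩ := hw
  obtain ⟨p, hp⟩ := hfQ.1.exists_walk_length_eq_dist
  exact hfP ((hfQ.restrict hf hp (hfxQ.mem_support hfx p hp) (hfyQ.mem_support hfy p hp)
    hxw hwy).extend hexP.1 (hexP.mem_support hex) (heyP.mem_support hey))

lemma IsBranching.eq_of_dist_eq {P Q : W × W} {x y : W} (hx : G.IsBranching P Q x)
    (hy : G.IsBranching P Q y) (h : G.dist Q.1 x = G.dist Q.1 y) : x = y := by
  obtain ⟨-, fx, hfx, hfxQ, -⟩ := hx
  obtain ⟨-, fy, hfy, hfyQ, -⟩ := hy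
  obtain ⟨p, hp⟩ := hfxQ.1.exists_walk_length_eq_dist
  exact eq_of_dist_eq_of_mem_support hp (hfxQ.mem_support hfx p hp)
    (hfyQ.mem_support hfy p hp) h

lemma not_three_isBranching {P Q : W × W} {x y z : W} (hx : G.IsBranching P Q x)
    (hy : G.IsBranching P Q y) (hz : G.IsBranching P Q z) (hxy : x ≠ y) (hxz : x ≠ z) :
    y = z := by
  have hxy' := mt (hx.eq_of_dist_eq hy) hxy
  have hxz' := mt (hx.eq_of_dist_eq hz) hxz
  by_contra hyz
  have hyz' := mt (hy.eq_of_dist_eq hz) hyz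
  have h₁ := not_isBranching_of_dist_lt hx hy hz
  have h₂ := not_isBranching_of_dist_lt hx hz hy
  have h₃ := not_isBranching_of_dist_lt hy hx hz
  have h₄ := not_isBranching_of_dist_lt hy hz hx
  have h₅ := not_isBranching_of_dist_lt hz hx hy
  have h₆ := not_isBranching_of_dist_lt hz hy hx
  omega

/-- At most two edges at a vertex are essential for the same pair. -/
lemma not_three_isEssential {u v w a b c : W} (hab : a ≠ b) (hac : a ≠ c) (hbc : b ≠ c)
    (ha : G.IsEssential u v s(w, a)) (hb : G.IsEssential u v s(w, b)) :
    ¬ G.IsEssential u v s(w, c) := by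
  intro hc
  obtain ⟨p, hp⟩ := ha.1.exists_walk_length_eq_dist
  have key : ∀ z, G.IsEssential u v s(w, z) →
      z ∈ p.support ∧ (G.dist u z = G.dist u w + 1 ∨ G.dist u z + 1 = G.dist u w) := by
    intro z hz
    have hzp := hz.mem_support (Sym2.mem_mk_right w z) p hp
    have hwp := hz.mem_support (Sym2.mem_mk_left w z) p hp
    have hadj : G.Adj w z := p.adj_of_mem_edges (hz.2 p hp)
    have hne := mt (eq_of_dist_eq_of_mem_support hp hwp hzp) hadj.ne
    have h := hadj.diff_dist_adj (u := u)
    exact ⟨hzp, by omega⟩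
  obtain ⟨ha', hda⟩ := key a ha
  obtain ⟨hb', hdb⟩ := key b hb
  obtain ⟨hc', hdc⟩ := key c hc
  have h₁ := mt (eq_of_dist_eq_of_mem_support hp ha' hb') hab
  have h₂ := mt (eq_of_dist_eq_of_mem_support hp ha' hc') hac
  have h₃ := mt (eq_of_dist_eq_of_mem_support hp hb' hc') hbc
  omega

lemma exists_isBranching {V : Type*} (ι : V → W)
    (hG : ∀ e ∈ G.edgeSet, ∃ u v, G.IsEssential (ι u) (ι v) e) {w : W} [Finite W]
    (hw : 2 < (G.neighborSet w).ncard) :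
    ∃ P : (V × V) × (V × V), G.IsBranching (P.1.map ι ι) (P.2.map ι ι) w := by
  obtain ⟨a, b, c, ha, hb, hc, hab, hac, hbc⟩ := (Set.two_lt_ncard_iff).1 hw
  obtain ⟨u, v, huv⟩ := hG s(w, a) ha
  by_cases h : G.IsEssential (ι u) (ι v) s(w, b)
  · obtain ⟨u', v', huv'⟩ := hG s(w, c) hc
    exact ⟨((u, v), (u', v')), ⟨_, Sym2.mem_mk_left w a, huv⟩, _, Sym2.mem_mk_left w c, huv',
      not_three_isEssential hab hac hbc huv h⟩
  · obtain ⟨u', v', huv'⟩ := hG s(w, b) hb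
    refine ⟨((u, v), (u', v')), ⟨_, Sym2.mem_mk_left w a, huv⟩, _, ?_, huv', h⟩
    exact Sym2.mem_mk_left w b

/-- If every edge of `G` is essential for a pair of terminals, then there are at most `2 n⁴`
vertices of degree at least three, where `n` is the number of terminals. -/
lemma card_le_of_forall_isEssential {V U : Type*} [Fintype V] [Fintype U] [Finite W]
    (ι : V → W) (j : U → W) (hj : j.Injective)
    (hG : ∀ e ∈ G.edgeSet, ∃ u v, G.IsEssential (ι u) (ι v) e)
    (hU : ∀ x, 2 < (G.neighborSet (j x)).ncard) :
    Fintype.card U ≤ 2 * Fintype.card V ^ 4 := by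
  classical
  choose f hf using fun x => exists_isBranching ι hG (hU x)
  have h := Finset.card_le_mul_card_image_of_maps_to (f := f) (s := Finset.univ)
    (t := Finset.univ) (fun _ _ => Finset.mem_univ _) 2 (fun P _ => by
      by_contra! hP
      obtain ⟨x, hx, y, hy, z, hz, hxy, hxz, hyz⟩ := Finset.two_lt_card.1 hP
      simp only [Finset.mem_filter, Finset.mem_univ, true_and] at hx hy hz
      have hx' := hf x
      have hy' := hf y
      have hz' := hf z
      rw [hx] at hx'
      rw [hy] at hy'
      rw [hz] at hz'
      exact hyz (hj (not_three_isBranching hx' hy' hz' (hj.ne hxy) (hj.ne hxz))))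
  simp only [Finset.card_univ, Fintype.card_prod] at h
  calc _ ≤ _ := h
    _ = _ := by ring

/-- The graph obtained from `G` by deleting `w` and joining its neighbours to each other; the
vertices other than `w` are labelled by `j`. -/
def bypass {W' : Type*} (G : SimpleGraph W) (w : W) (j : W' → W) : SimpleGraph W' where
  Adj x y := x ≠ y ∧ (G.Adj (j x) (j y) ∨ G.Adj (j x) w ∧ G.Adj w (j y))
  symm := ⟨fun _ _ h => ⟨h.1.symm, h.2.imp (fun h => h.symm) (fun h => ⟨h.2.symm, h.1.symm⟩)⟩⟩
  loopless := ⟨fun _ h => h.1 rfl⟩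

lemma bypass_adj {W' : Type*} {w : W} {j : W' → W} {x y : W'} :
    (G.bypass w j).Adj x y ↔ x ≠ y ∧ (G.Adj (j x) (j y) ∨ G.Adj (j x) w ∧ G.Adj w (j y)) :=
  Iff.rfl

lemma ncard_neighborSet_bypass_le {W' : Type*} [Finite W] {w : W} {j : W' → W}
    (hj : j.Injective) (hjw : ∀ x, j x ≠ w) (hw : (G.neighborSet w).ncard ≤ 2) (x : W') :
    ((G.bypass w j).neighborSet x).ncard ≤ (G.neighborSet (j x)).ncard := by
  rw [← Set.ncard_image_of_injective _ hj]
  by_cases h : G.Adj (j x) w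
  · have hsub : j '' (G.bypass w j).neighborSet x ⊆
        (G.neighborSet (j x) \ {w}) ∪ (G.neighborSet w \ {j x}) := by
      rintro _ ⟨y, hxy, rfl⟩
      obtain ⟨hne, hy⟩ := bypass_adj.1 hxy
      rcases hy with hy | hy
      · exact Or.inl ⟨hy, hjw y⟩
      · exact Or.inr ⟨hy.2, fun h => hne (hj h).symm⟩
    have h₁ := Set.ncard_le_ncard hsub
    have h₂ := Set.ncard_union_le (G.neighborSet (j x) \ {w}) (G.neighborSet w \ {j x})
    have h₃ := Set.ncard_sdiff_singleton_add_one (s := G.neighborSet (j x)) h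
    have h₄ := Set.ncard_sdiff_singleton_add_one (s := G.neighborSet w) h.symm
    omega
  · refine Set.ncard_le_ncard ?_
    rintro _ ⟨y, hxy, rfl⟩
    exact (bypass_adj.1 hxy).2.resolve_right fun h' => h h'.1

lemma edist_bypass_le_length {W' : Type*} {w : W} {j : W' → W} (hj : j.Injective)
    (hjw : ∀ x, j x ≠ w) (hjs : ∀ z, z ≠ w → ∃ x, j x = z) (n : ℕ) :
    ∀ (x y : W') (p : G.Walk (j x) (j y)), p.length = n → (G.bypass w j).edist x y ≤ n := by
  induction n using Nat.strong_induction_on with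
  | _ n ih =>
    have step : ∀ (x y z : W'), (x = z ∨ (G.bypass w j).Adj x z) → ∀ m < n,
        (G.bypass w j).edist z y ≤ m → (G.bypass w j).edist x y ≤ n := by
      intro x y z hxz m hm hzy
      have h₁ : (G.bypass w j).edist x z ≤ 1 := edist_le_one_iff_adj_or_eq.2 hxz.symm
      calc _ ≤ (G.bypass w j).edist x z + (G.bypass w j).edist z y := SimpleGraph.edist_triangle
        _ ≤ 1 + m := add_le_add h₁ hzy
        _ ≤ n := by exact_mod_cast (by omega : 1 + m ≤ n)
    intro x y p hp
    generalize hu : j x = u at p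
    generalize hv : j y = v at p
    cases p with
    | nil =>
      obtain rfl := hj (hu.trans hv.symm)
      simp
    | @cons _ z _ h p =>
      subst hv
      rw [Walk.length_cons] at hp
      by_cases hz : z = w
      · generalize hv : j y = v at p
        cases p with
        | nil => exact absurd (hv.trans hz) (hjw y)
        | @cons _ z' _ h' p =>
          subst hv hz hu
          rw [Walk.length_cons] at hp
          obtain ⟨t, rfl⟩ := hjs z' h'.ne'
          refine step x y t ?_ p.length (by omega) (ih p.length (by omega) t y p rfl)
          by_cases hxt : x = t
          · exact Or.inl hxt
          · exact Or.inr (bypass_adj.2 ⟨hxt, Or.inr ⟨h, h'⟩⟩)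
      · subst hu
        obtain ⟨t, rfl⟩ := hjs z hz
        exact step x y t (Or.inr (bypass_adj.2 ⟨fun hxt => h.ne (congrArg j hxt), Or.inl h⟩)) p.length
          (by omega) (ih p.length (by omega) t y p rfl)

lemma edist_bypass_le {W' : Type*} {w : W} {j : W' → W} (hj : j.Injective)
    (hjw : ∀ x, j x ≠ w) (hjs : ∀ z, z ≠ w → ∃ x, j x = z) (x y : W') :
    (G.bypass w j).edist x y ≤ G.edist (j x) (j y) := by
  by_cases h : G.Reachable (j x) (j y)
  · obtain ⟨p, hp⟩ := h.exists_walk_length_eq_edist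
    rw [← hp]
    exact edist_bypass_le_length hj hjw hjs _ x y p rfl
  · rw [edist_eq_top_of_not_reachable h]
    exact le_top

/-- Host graphs on `V ⊕ U` with degree bound `Δ` whose distances on `V` are at most `D`. -/
def IsHost {V U : Type*} (Δ : ℕ) (D : V → V → ℕ∞) (G : SimpleGraph (V ⊕ U)) : Prop :=
  (∀ w, (G.neighborSet w).ncard ≤ Δ) ∧ ∀ u v : V, G.edist (Sum.inl u) (Sum.inl v) ≤ D u v

/-- Removing an edge from an inclusion-minimal host graph breaks a distance constraint. -/
lemma exists_isEssential_of_minimal {V U : Type*} [Finite V] [Finite U] {Δ : ℕ}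
    {D : V → V → ℕ∞} {G : SimpleGraph (V ⊕ U)} (hG : Minimal (IsHost Δ D) G)
    {e : Sym2 (V ⊕ U)} (he : e ∈ G.edgeSet) :
    ∃ u v : V, G.IsEssential (Sum.inl u) (Sum.inl v) e := by
  by_contra! hne
  have hle : G.deleteEdges {e} ≤ G := G.deleteEdges_le {e}
  have hH : IsHost Δ D (G.deleteEdges {e}) := by
    refine ⟨fun w => (Set.ncard_le_ncard fun x hx => hle hx).trans (hG.prop.1 w),
      fun u v => ?_⟩
    refine le_trans ?_ (hG.prop.2 u v)
    by_cases huv : G.Reachable (Sum.inl u : V ⊕ U) (Sum.inl v)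
    · have := hne u v
      simp only [IsEssential, huv, true_and, not_forall] at this
      obtain ⟨p, hp, hep⟩ := this
      have h := edist_le (p.toDeleteEdge e hep)
      rwa [Walk.toDeleteEdge, Walk.toDeleteEdges, Walk.length_transfer, hp,
        huv.coe_dist_eq_edist] at h
    · rw [edist_eq_top_of_not_reachable huv]
      exact le_top
  have := hG.le_of_le hH hle
  rw [← edgeSet_subset_edgeSet] at this
  simpa using this he

lemma IsHost.comap {V U U' : Type*} [Finite V] [Finite U] {Δ : ℕ} {D : V → V → ℕ∞}
    {G : SimpleGraph (V ⊕ U)} (hG : IsHost Δ D G) (f : U' ≃ U) :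
    IsHost Δ D (G.comap (Sum.map id f)) := by
  have hinj : (Sum.map id f : V ⊕ U' → V ⊕ U).Injective :=
    Function.Injective.sumMap Function.injective_id f.injective
  refine ⟨fun w => le_trans ?_ (hG.1 (Sum.map id f w)), fun u v => le_trans ?_ (hG.2 u v)⟩
  · rw [← Set.ncard_image_of_injective _ hinj]
    exact Set.ncard_le_ncard (by rintro _ ⟨y, hy, rfl⟩; exact hy)
  · by_cases h : G.Reachable (Sum.inl u : V ⊕ U) (Sum.inl v)
    · obtain ⟨p, hp⟩ := h.exists_walk_length_eq_edist
      let φ : G →g G.comap (Sum.map id f) :=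
        ⟨Sum.map id f.symm, fun {a b} hab => by
          rw [comap_adj]
          simpa [Sum.map_map] using hab⟩
      rw [← hp, ← p.length_map φ]
      exact edist_le (p.map φ)
    · rw [edist_eq_top_of_not_reachable h]
      exact le_top

/-- A Steiner node of degree at most two can be bypassed. -/
lemma IsHost.bypass {V U : Type*} [Finite V] [Finite U] {Δ : ℕ} {D : V → V → ℕ∞}
    {G : SimpleGraph (V ⊕ U)} (hG : IsHost Δ D G) {w : U}
    (hw : (G.neighborSet (Sum.inr w)).ncard ≤ 2) :
    IsHost Δ D (G.bypass (Sum.inr w) (Sum.map id (Subtype.val : {x // x ≠ w} → U))) := by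
  have hinj : (Sum.map id (Subtype.val : {x // x ≠ w} → U) : V ⊕ {x // x ≠ w} → V ⊕ U).Injective :=
    Function.Injective.sumMap Function.injective_id Subtype.val_injective
  have hne : ∀ x, (Sum.map id (Subtype.val : {x // x ≠ w} → U) : V ⊕ _ → V ⊕ U) x ≠ Sum.inr w := by
    rintro (x | x)
    · simp
    · simpa using x.2
  refine ⟨fun x => (ncard_neighborSet_bypass_le hinj hne hw x).trans (hG.1 _),
    fun u v => (edist_bypass_le hinj hne ?_ _ _).trans (hG.2 u v)⟩
  rintro (z | z) hz
  · exact ⟨Sum.inl z, rfl⟩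
  · exact ⟨Sum.inr ⟨z, fun h => hz (congrArg _ h)⟩, rfl⟩

/-- Every host graph can be replaced by one with at most `2 |V| ^ 4` Steiner nodes. -/
lemma IsHost.exists_card_le {V U : Type*} [Fintype V] [Fintype U] {Δ : ℕ} {D : V → V → ℕ∞}
    {G : SimpleGraph (V ⊕ U)} (hG : IsHost Δ D G) :
    ∃ m ≤ 2 * Fintype.card V ^ 4, ∃ H : SimpleGraph (V ⊕ Fin m), IsHost Δ D H := by
  classical
  have hex : ∃ m, ∃ H : SimpleGraph (V ⊕ Fin m), IsHost Δ D H :=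
    ⟨_, _, hG.comap (Fintype.equivFin U).symm⟩
  obtain ⟨H₀, hH₀⟩ := Nat.find_spec hex
  refine ⟨Nat.find hex, ?_, H₀, hH₀⟩
  obtain ⟨H, -, hH⟩ := (Set.toFinite {H | IsHost Δ D H}).exists_le_minimal hH₀
  have h := card_le_of_forall_isEssential (G := H) Sum.inl Sum.inr Sum.inr_injective
    (fun e he => exists_isEssential_of_minimal hH he) (fun w => by
      by_contra! hw
      have hlt : Fintype.card {x // x ≠ w} < Nat.find hex := by
        simpa using Fintype.card_subtype_lt (p := (· ≠ w)) (x := w) (by simp)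
      exact Nat.find_min hex hlt
        ⟨_, (hH.prop.bypass hw).comap (Fintype.equivFin {x // x ≠ w}).symm⟩)
  simpa using h

end SimpleGraph

/-- there is a universal constant `C > 0` such that every instance of
bounded-degree network design with Steiner nodes has an optimal solution with at most
`C·n⁴` vertices: a host graph `G` (on `V ⊕ U`) of maximum degree at most `Δ`, whose
expected path length is at most that of every bounded-degree host graph containing `V`. -/
theorem statement_11 :
    ∃ C : ℝ, 0 < C ∧
      ∀ (V : Type) (_ : Fintype V) (n : ℕ), Fintype.card V = n → 1 ≤ n →
      ∀ (p : V → V → ℝ), IsDemandDistribution p →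
      ∀ (Δ : ℕ), 1 ≤ Δ →
      ∃ (U : Type) (_ : Fintype U) (G : SimpleGraph (V ⊕ U)),
        (∀ w : V ⊕ U, (G.neighborSet w).ncard ≤ Δ) ∧
        (Fintype.card (V ⊕ U) : ℝ) ≤ C * (n : ℝ) ^ 4 ∧
        ∀ (U' : Type) (_ : Fintype U') (G' : SimpleGraph (V ⊕ U')),
          (∀ w : V ⊕ U', (G'.neighborSet w).ncard ≤ Δ) →
          expectedPathLength p G Sum.inl ≤ expectedPathLength p G' Sum.inl := by
  refine ⟨3, by norm_num, fun V _ n hn hn1 p hp Δ hΔ => ?_⟩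
  let Host := {H : Σ m : Fin (2 * n ^ 4 + 1), SimpleGraph (V ⊕ Fin m) //
    ∀ w, (H.2.neighborSet w).ncard ≤ Δ}
  have : Nonempty Host := ⟨⟨⟨0, ⊥⟩, fun w => by
    change {x | False}.ncard ≤ Δ
    simp⟩⟩
  obtain ⟨⟨⟨m, G⟩, hG⟩, hmin⟩ :=
    Finite.exists_min fun H : Host => expectedPathLength p H.1.2 Sum.inl
  refine ⟨Fin m, inferInstance, G, hG, ?_, fun U' _ G' hG' => ?_⟩
  · have h₁ : (m : ℕ) ≤ 2 * n ^ 4 := Nat.lt_succ_iff.1 m.2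
    have h₂ : n ≤ n ^ 4 := Nat.le_self_pow (by norm_num) n
    rw [Fintype.card_sum, Fintype.card_fin, hn]
    exact_mod_cast (by omega : n + m ≤ 3 * n ^ 4)
  · have hhost : SimpleGraph.IsHost Δ (fun u v => G'.edist (Sum.inl u) (Sum.inl v)) G' :=
      ⟨hG', fun _ _ => le_rfl⟩
    obtain ⟨k, hk, H, hH, hdist⟩ := hhost.exists_card_le
    rw [hn] at hk
    refine (hmin ⟨⟨⟨k, Nat.lt_succ_iff.2 hk⟩, H⟩, hH⟩).trans ?_
    unfold expectedPathLength
    gcongr with u _ v _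
    exact hdist u v
end
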